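/- arXiv:0810.4039 — 6 statements merged into one kernel-verified Lean document; each statement's English description precedes it below -/
import Mathlib

section
/- Let (K,d) be a differential field of characteristic 0 and let (M,∂) be a differential module over K of dimension 3 with det M = 1. Suppose there exists F ∈ Sym²M with ∂F = 0 such that the symmetric bilinear form on M* determined by F is nondegenerate and admits a nonzero isotropic vector. Then there exists a differential module (N,∂_N) over K of dimension 2 with det N = 1 and an isomorphism of differential modules Sym²N ≅ M. -/
open Module

/-- `d` is a derivation on the field `K`. -/
def IsDeriv {K : Type} [Field K] (d : K → K) : Prop :=
  (∀ a b, d (a + b) = d a + d b) ∧ (∀ a b, d (a * b) = d a * b + a * d b)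

/-- `D` is a differential-module structure on `M` over the differential field `(K, d)`. -/
def IsDiff {K : Type} [Field K] (d : K → K) {M : Type} [AddCommGroup M] [Module K M]
    (D : M → M) : Prop :=
  (∀ x y, D (x + y) = D x + D y) ∧ (∀ (a : K) (m : M), D (a • m) = d a • m + a • D m)

/-- `det M = 1`: the matrix of `D` in some basis of `M` has trace `0`. -/
def TraceZero (K : Type) [Field K] {M : Type} [AddCommGroup M] [Module K M]
    (D : M → M) (n : ℕ) : Prop :=
  ∃ (b : Basis (Fin n) K M) (A : Matrix (Fin n) (Fin n) K),
    (∀ i, D (b i) = ∑ j, A j i • b j) ∧ Matrix.trace A = 0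

/-- The induced differential structure on the dual module. -/
def dualD {K : Type} [Field K] {d : K → K} {M : Type} [AddCommGroup M] [Module K M]
    {D : M → M} (hd : IsDeriv d) (hD : IsDiff d D) (φ : Module.Dual K M) :
    Module.Dual K M where
  toFun m := d (φ m) - φ (D m)
  map_add' x y := by
    simp only [map_add, hd.1, hD.1]; ring
  map_smul' a m := by
    simp only [map_smul, hD.2, map_add, smul_eq_mul, hd.2, RingHom.id_apply]; ring

/-- `M` is an irreducible differential module. -/
def IsIrr (K : Type) [Field K] {M : Type} [AddCommGroup M] [Module K M]
    (D : M → M) : Prop :=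
  (∃ m : M, m ≠ 0) ∧ ∀ W : Submodule K M, (∀ x ∈ W, D x ∈ W) → W = ⊥ ∨ W = ⊤

open Module

theorem aux_d {K : Type} [Field K] {d : K → K} (hd : IsDeriv d) :
    d 0 = 0 ∧ d 1 = 0 ∧ (∀ a, d (-a) = - d a) := by
  have h0 : d 0 = 0 := by have := hd.1 0 0; simp at this; exact this
  have h1 : d 1 = 0 := by have := hd.2 1 1; simp at this; exact this
  refine ⟨h0, h1, fun a => ?_⟩
  have := hd.1 a (-a)
  rw [add_neg_cancel, h0] at this
  linear_combination -this

/-- The Gram determinant in a trace-zero basis is constant. -/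
theorem aux_det {K : Type} [Field K] {d : K → K} (hd : IsDeriv d)
    (G A : Matrix (Fin 3) (Fin 3) K) (hA : A.trace = 0)
    (hs : ∀ i j, G i j = G j i)
    (hG : ∀ i j, d (G i j) = -∑ k, A i k * G k j - ∑ k, A j k * G i k) :
    d G.det = 0 := by
  obtain ⟨h0, h1, hn⟩ := aux_d hd
  rw [Matrix.det_fin_three]
  simp only [sub_eq_add_neg, hd.1, hd.2, hn, hG, Fin.sum_univ_three]
  rw [Matrix.trace_fin_three] at hA
  rw [hs 1 0, hs 2 0, hs 2 1]
  linear_combination (-2 * (G 0 0 * G 1 1 * G 2 2 + 2 * G 0 1 * G 1 2 * G 0 2 - G 0 0 * G 1 2 ^ 2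
    - G 0 1 ^ 2 * G 2 2 - G 0 2 ^ 2 * G 1 1)) * hA

theorem aux_hyp {K : Type} [Field K] [CharZero K] {V : Type} [AddCommGroup V] [Module K V]
    [FiniteDimensional K V] (hdim : Module.finrank K V = 3)
    (B : V →ₗ[K] V →ₗ[K] K) (hsym : ∀ φ ψ, B φ ψ = B ψ φ)
    (hnondeg : ∀ φ, (∀ ψ, B φ ψ = 0) → φ = 0)
    (hisotropic : ∃ φ : V, φ ≠ 0 ∧ B φ φ = 0) :
    ∃ (E : Basis (Fin 3) K V), B (E 0) (E 0) = 0 ∧ B (E 1) (E 1) = 0 ∧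
      B (E 0) (E 1) = 1 ∧ B (E 0) (E 2) = 0 ∧ B (E 1) (E 2) = 0 ∧ B (E 2) (E 2) ≠ 0 := by
  obtain ⟨e, he, hee⟩ := hisotropic
  obtain ⟨ψ, hψ⟩ : ∃ ψ, B e ψ ≠ 0 := by
    by_contra h
    push Not at h
    exact he (hnondeg e h)
  obtain ⟨f, hef, hff⟩ : ∃ f, B e f = 1 ∧ B f f = 0 := by
    refine ⟨(B e ψ)⁻¹ • (ψ - (B ψ ψ / (2 * B e ψ)) • e), ?_, ?_⟩
    · simp [hee, hψ]
    · simp only [map_smul, map_sub, LinearMap.smul_apply, LinearMap.sub_apply, smul_eq_mul, hee,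
        hsym ψ e]
      field_simp
      ring
  obtain ⟨g, hg, hg0⟩ : ∃ g ∈ LinearMap.ker ((B e).prod (B f)), g ≠ 0 := by
    apply Submodule.exists_mem_ne_zero_of_ne_bot
    apply LinearMap.ker_ne_bot_of_finrank_lt
    simp [hdim]
  have hg' : B e g = 0 ∧ B f g = 0 := by simpa [LinearMap.mem_ker] using hg
  obtain ⟨heg, hfg⟩ := hg'
  have hli : LinearIndependent K ![e, f, g] := by
    rw [Fintype.linearIndependent_iff]
    intro t ht
    simp only [Fin.sum_univ_three, Matrix.cons_val_zero, Matrix.cons_val_one, Matrix.cons_val] at ht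
    have h1 := congrArg (B e) ht
    have h0 := congrArg (B f) ht
    simp [hee, hef, heg, hff, hfg, hsym f e] at h0 h1
    have h2 : t 2 = 0 := by simpa [h0, h1, hg0] using ht
    intro i
    fin_cases i <;> assumption
  let E : Basis (Fin 3) K V := basisOfLinearIndependentOfCardEqFinrank hli (by simp [hdim])
  have hE : ⇑E = ![e, f, g] := by simp [E]
  refine ⟨E, ?_⟩
  have E0 : E 0 = e := by simp [hE]
  have E1 : E 1 = f := by simp [hE]
  have E2 : E 2 = g := by simp [hE]
  rw [E0, E1, E2]
  refine ⟨hee, hff, hef, heg, hfg, fun hgg => hg0 (hnondeg g fun χ => ?_)⟩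
  rw [← E.sum_repr χ, Fin.sum_univ_three]
  simp only [map_add, map_smul]
  simp [E0, E1, E2, hgg, hsym g e, hsym g f, heg, hfg]

theorem aux_final {K : Type} [Field K] [CharZero K] (d : K → K) (hd : IsDeriv d)
    (M : Type) [AddCommGroup M] [Module K M] [FiniteDimensional K M]
    (D : M → M) (hD : IsDiff d D)
    (E : Basis (Fin 3) K (Module.Dual K M)) (a h r : K)
    (h0 : dualD hd hD (E 0) = a • E 0 + h • E 2)
    (h1 : dualD hd hD (E 1) = -a • E 1 + r • E 2)
    (h2 : dualD hd hD (E 2) = (2 * r) • E 0 + (2 * h) • E 1) :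
    ∃ DN : (Fin 2 → K) → (Fin 2 → K), IsDiff d DN ∧ TraceZero K DN 2 ∧
      ∃ β : (Fin 2 → K) →ₗ[K] (Fin 2 → K) →ₗ[K] M,
        (∀ x y, β x y = β y x) ∧
        (∀ x y, D (β x y) = β (DN x) y + β x (DN y)) ∧
        Submodule.span K {m : M | ∃ x y, β x y = m} = ⊤ := by
  obtain ⟨d0, d1, dn⟩ := aux_d hd
  let X : Basis (Fin 3) K M := E.dualBasis.map (Module.evalEquiv K M).symm
  have hX : ∀ i j, E i (X j) = if i = j then 1 else 0 := by
    intro i j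
    have : E i (X j) = E.dualBasis j (E i) := by
      simp only [X, Basis.map_apply]
      exact Module.apply_evalEquiv_symm_apply ..
    rw [this, Basis.dualBasis_apply_self]
  have hext : ∀ m m' : M, (∀ i, E i m = E i m') → m = m' := by
    intro m m' hm
    rw [← sub_eq_zero, ← Module.forall_dual_apply_eq_zero_iff K]
    intro φ
    rw [← E.sum_repr φ, Fin.sum_univ_three]
    simp only [map_sub, LinearMap.add_apply, LinearMap.smul_apply, hm, sub_self]
  have hED : ∀ i m, E i (D m) = d (E i m) - dualD hd hD (E i) m := by
    intro i m
    simp [dualD]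
  let DN : (Fin 2 → K) → (Fin 2 → K) := fun s =>
    ![d (s 0) - a / 2 * s 0 - h * s 1, d (s 1) - r * s 0 + a / 2 * s 1]
  let β : (Fin 2 → K) →ₗ[K] (Fin 2 → K) →ₗ[K] M := LinearMap.mk₂ K
    (fun s t => (s 0 * t 0) • X 0 + (s 0 * t 1 + s 1 * t 0) • X 2 + (s 1 * t 1) • X 1)
    (by intros; simp only [Pi.add_apply]; module)
    (by intros; simp only [Pi.smul_apply, smul_eq_mul]; module)
    (by intros; simp only [Pi.add_apply]; module)
    (by intros; simp only [Pi.smul_apply, smul_eq_mul]; module)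
  have hβ : ∀ s t, β s t =
    (s 0 * t 0) • X 0 + (s 0 * t 1 + s 1 * t 0) • X 2 + (s 1 * t 1) • X 1 := fun s t => rfl
  have hβ0 : ∀ s t, E 0 (β s t) = s 0 * t 0 := by intro s t; simp [hβ, hX]
  have hβ1 : ∀ s t, E 1 (β s t) = s 1 * t 1 := by intro s t; simp [hβ, hX]
  have hβ2 : ∀ s t, E 2 (β s t) = s 0 * t 1 + s 1 * t 0 := by intro s t; simp [hβ, hX]
  refine ⟨DN, ⟨?_, ?_⟩, ?_, β, ?_, ?_, ?_⟩
  · intro x y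
    ext i
    fin_cases i <;> simp [DN, hd.1] <;> ring
  · intro x y
    ext i
    fin_cases i <;> simp [DN, hd.2] <;> ring
  · refine ⟨Pi.basisFun K (Fin 2), !![-(a / 2), -h; -r, a / 2], ?_, by simp [Matrix.trace_fin_two]⟩
    intro i
    ext j
    fin_cases i <;> fin_cases j <;> simp [DN, Fin.sum_univ_two, d0, d1]
  · intro x y
    rw [hβ, hβ]; module
  · intro x y
    apply hext
    intro i
    rw [hED, map_add]
    fin_cases i
    · simp only [Fin.zero_eta, h0, LinearMap.add_apply, LinearMap.smul_apply, hβ0, hβ2]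
      simp [DN, hd.1, hd.2]; ring
    · simp only [Fin.mk_one, h1, LinearMap.add_apply, LinearMap.smul_apply, hβ1, hβ2]
      simp [DN, hd.1, hd.2]; ring
    · simp only [Fin.reduceFinMk, h2, LinearMap.add_apply, LinearMap.smul_apply, hβ0, hβ1, hβ2]
      simp [DN, hd.1, hd.2]; ring
  · rw [eq_top_iff, ← X.span_eq, Submodule.span_le]
    rintro _ ⟨i, rfl⟩
    apply Submodule.subset_span
    fin_cases i
    · exact ⟨![1, 0], ![1, 0], by simp [hβ]⟩
    · exact ⟨![0, 1], ![0, 1], by simp [hβ]⟩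
    · exact ⟨![1, 0], ![0, 1], by simp [hβ]⟩

/-- An irreducible-type construction: if `M` is a `3`-dimensional
differential module with `det M = 1` carrying a constant `F ∈ Sym²M` (viewed as a
symmetric bilinear form on the dual `M*`) which is nondegenerate and has a nonzero
isotropic vector, then `M ≅ Sym²N` for a `2`-dimensional differential module `N`
with `det N = 1`. -/
theorem stmt0 {K : Type} [Field K] [CharZero K] (d : K → K) (hd : IsDeriv d)
    (M : Type) [AddCommGroup M] [Module K M] [FiniteDimensional K M]
    (hdim : Module.finrank K M = 3)
    (D : M → M) (hD : IsDiff d D) (hdet : TraceZero K D 3)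
    -- `F ∈ Sym² M`, viewed as a symmetric bilinear form `B` on the dual of `M`
    (B : Module.Dual K M →ₗ[K] Module.Dual K M →ₗ[K] K)
    (hsym : ∀ φ ψ, B φ ψ = B ψ φ)
    -- `∂ F = 0`
    (hconst : ∀ φ ψ, d (B φ ψ) = B (dualD hd hD φ) ψ + B φ (dualD hd hD ψ))
    (hnondeg : ∀ φ, (∀ ψ, B φ ψ = 0) → φ = 0)
    (hisotropic : ∃ φ : Module.Dual K M, φ ≠ 0 ∧ B φ φ = 0) :
    -- there is a differential module `N = (K², D_N)` of dimension 2 with `det N = 1` ...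
    ∃ DN : (Fin 2 → K) → (Fin 2 → K), IsDiff d DN ∧ TraceZero K DN 2 ∧
      -- ... and an isomorphism of differential modules `Sym² N ≅ M`, given by a
      -- symmetric bilinear `∂`-compatible map `β : N × N → M` inducing a surjection
      -- (hence, `dim Sym²N = 3 = dim M`, an isomorphism) `Sym² N → M`.
      ∃ β : (Fin 2 → K) →ₗ[K] (Fin 2 → K) →ₗ[K] M,
        (∀ x y, β x y = β y x) ∧
        (∀ x y, D (β x y) = β (DN x) y + β x (DN y)) ∧
        Submodule.span K {m : M | ∃ x y, β x y = m} = ⊤ := by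
  obtain ⟨d0, d1, dn⟩ := aux_d hd
  obtain ⟨b, A, hA, htr⟩ := hdet
  have hdimD : Module.finrank K (Module.Dual K M) = 3 := by
    rw [Subspace.dual_finrank_eq, hdim]
  obtain ⟨E, h00, h11, h01, h02, h12, h22⟩ := aux_hyp hdimD B hsym hnondeg hisotropic
  -- the Gram matrix in the dual basis of `b`
  let G : Matrix (Fin 3) (Fin 3) K := Matrix.of fun i j => B (b.dualBasis i) (b.dualBasis j)
  have hdb : ∀ i, dualD hd hD (b.dualBasis i) = -∑ k, A i k • b.dualBasis k := by
    intro i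
    apply b.ext
    intro j
    have : dualD hd hD (b.dualBasis i) (b j) = d (b.dualBasis i (b j)) - b.dualBasis i (D (b j)) :=
      rfl
    rw [this, hA]
    simp only [map_sum, map_smul, Basis.dualBasis_apply_self, smul_eq_mul, LinearMap.neg_apply,
      LinearMap.sum_apply, LinearMap.smul_apply]
    have hz : d (if j = i then (1 : K) else 0) = 0 := by split_ifs <;> assumption
    simp [hz]
  have hGd : d G.det = 0 := by
    apply aux_det hd G A htr
    · intro i j; exact hsym _ _
    · intro i j
      change d (B _ _) = _
      rw [hconst, hdb, hdb]
      simp [G, sub_eq_add_neg]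
  let P : Matrix (Fin 3) (Fin 3) K := Matrix.of fun i j => E i (b j)
  have hEP : ∀ i, E i = ∑ k, P i k • b.dualBasis k := by
    intro i
    apply b.ext
    intro j
    simp [P, LinearMap.sum_apply, Basis.dualBasis_apply_self]
  have hPG : P * G * P.transpose = Matrix.of fun i j => B (E i) (E j) := by
    ext i j
    rw [Matrix.of_apply, hEP i, hEP j]
    simp only [Matrix.mul_apply, Matrix.transpose_apply, Fin.sum_univ_three, map_add, map_smul,
      LinearMap.add_apply, LinearMap.smul_apply, smul_eq_mul, G, Matrix.of_apply]
    ring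
  have hdetP := congrArg Matrix.det hPG
  rw [Matrix.det_mul, Matrix.det_mul, Matrix.det_transpose,
    Matrix.det_fin_three (Matrix.of fun i j => B (E i) (E j))]
    at hdetP
  simp only [Matrix.of_apply, h00, h11, h01, h02, h12, hsym (E 1) (E 0), hsym (E 2) (E 0),
    hsym (E 2) (E 1)] at hdetP
  have hP0 : P.det ≠ 0 := by
    intro h; rw [h] at hdetP; apply h22; linear_combination hdetP
  have hG0 : G.det ≠ 0 := by
    intro h; rw [h] at hdetP; apply h22; linear_combination hdetP
  -- rescaled basis
  let w : Fin 3 → Kˣ := ![1, Units.mk0 (G.det / 2) (by simpa using hG0), (Units.mk0 _ hP0)⁻¹]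
  let E' := E.unitsSMul w
  have e0 : E' 0 = E 0 := by simp [E', w, Basis.unitsSMul_apply]
  have e1 : E' 1 = (G.det / 2) • E 1 := by
    simp [E', w, Basis.unitsSMul_apply, Units.smul_def]
  have e2 : E' 2 = (P.det)⁻¹ • E 2 := by
    simp [E', w, Basis.unitsSMul_apply, Units.smul_def]
  have d2 : d (G.det / 2) = 0 := by
    have h := hd.2 (G.det / 2) 2
    have h2 : d 2 = 0 := by rw [← one_add_one_eq_two, hd.1, d1, add_zero]
    rw [div_mul_cancel₀ _ (two_ne_zero), hGd, h2] at h
    simpa using h.symm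
  have k00 : B (E' 0) (E' 0) = 0 := by rw [e0, h00]
  have k11 : B (E' 1) (E' 1) = 0 := by simp [e1, h11]
  have k01 : B (E' 0) (E' 1) = G.det / 2 := by simp [e0, e1, h01]
  have k02 : B (E' 0) (E' 2) = 0 := by simp [e0, e2, h02]
  have k12 : B (E' 1) (E' 2) = 0 := by simp [e1, e2, h12]
  have k22 : B (E' 2) (E' 2) = -G.det := by
    simp only [e2, map_smul, LinearMap.smul_apply, smul_eq_mul]
    field_simp
    linear_combination hdetP
  clear_value E'
  have dng : d (-G.det) = 0 := by rw [dn, hGd, neg_zero]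
  generalize G.det = δ at *
  have expand : ∀ φ : Module.Dual K M, ∃ p q s : K, φ = p • E' 0 + q • E' 1 + s • E' 2 := by
    intro φ
    refine ⟨E'.repr φ 0, E'.repr φ 1, E'.repr φ 2, ?_⟩
    conv_lhs => rw [← E'.sum_repr φ, Fin.sum_univ_three]
  obtain ⟨a, b0, h, H0⟩ := expand (dualD hd hD (E' 0))
  obtain ⟨p, q, r, H1⟩ := expand (dualD hd hD (E' 1))
  obtain ⟨s, t, z, H2⟩ := expand (dualD hd hD (E' 2))
  have c00 := hconst (E' 0) (E' 0)
  have c11 := hconst (E' 1) (E' 1)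
  have c22 := hconst (E' 2) (E' 2)
  have c01 := hconst (E' 0) (E' 1)
  have c02 := hconst (E' 0) (E' 2)
  have c12 := hconst (E' 1) (E' 2)
  rw [H0] at c00 c01 c02
  rw [H1] at c11 c01 c12
  rw [H2] at c22 c02 c12
  simp only [map_add, map_smul, LinearMap.add_apply, LinearMap.smul_apply, smul_eq_mul,
    hsym (E' 1) (E' 0), hsym (E' 2) (E' 0), hsym (E' 2) (E' 1), k00, k11, k01, k02, k12, k22,
    d0, d2, dng] at c00 c11 c22 c01 c02 c12
  have hb0 : b0 = 0 := mul_left_cancel₀ hG0 (by linear_combination -c00)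
  have hp : p = 0 := mul_left_cancel₀ hG0 (by linear_combination -c11)
  have hz : z = 0 := mul_left_cancel₀ hG0 (by linear_combination c22 / 2)
  have hq : q = -a := mul_left_cancel₀ hG0 (by linear_combination -2 * c01)
  have ht : t = 2 * h := mul_left_cancel₀ hG0 (by linear_combination -2 * c02)
  have hs : s = 2 * r := mul_left_cancel₀ hG0 (by linear_combination -2 * c12)
  subst hb0 hp hz hq ht hs
  exact aux_final d hd M D hD E' a h r (by rw [H0]; module) (by rw [H1]; module)
    (by rw [H2]; module)
end

section
/- Let (K,d) be a differential field of characteristic 0 and let (N,∂) be a differential module over K of dimension 2 with det N = 1, with a basis n₁, n₂ in which the matrix of ∂ has trace 0. Let M := Sym²N with basis m₁₁ = n₁·n₁, m₂₂ = n₂·n₂, m₁₂ = n₁·n₂. Then the element F := m₁₂·m₁₂ − m₁₁·m₂₂ ∈ Sym²M satisfies ∂F = 0, and the symmetric bilinear form on M* determined by F is nondegenerate and admits a nonzero isotropic vector. -/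
open Module

/-- If `N` is a `2`-dimensional differential module with a basis
`n₁, n₂` in which the matrix of `∂` has trace `0`, and `M = Sym² N` (realized as a
`3`-dimensional differential module `M` together with a symmetric `∂`-compatible
bilinear map `β : N × N → M` whose image spans `M`), then the element
`F = m₁₂·m₁₂ − m₁₁·m₂₂ ∈ Sym² M` (viewed, via the canonical identification, as the
symmetric bilinear form `B(φ,ψ) = 2 φ(m₁₂) ψ(m₁₂) − φ(m₁₁) ψ(m₂₂) − φ(m₂₂) ψ(m₁₁)`
on the dual of `M`) satisfies `∂ F = 0`, is nondegenerate, and admits a nonzero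
isotropic vector. -/
theorem stmt1 {K : Type} [Field K] [CharZero K] (d : K → K) (hd : IsDeriv d)
    (N : Type) [AddCommGroup N] [Module K N] [FiniteDimensional K N]
    (DN : N → N) (hDN : IsDiff d DN)
    -- basis `n₁ = n 0`, `n₂ = n 1` in which the matrix of `∂` has trace 0
    (n : Basis (Fin 2) K N) (A : Matrix (Fin 2) (Fin 2) K)
    (hA : ∀ i, DN (n i) = ∑ j, A j i • n j) (htr : Matrix.trace A = 0)
    -- `M := Sym² N`, realized abstractly
    (M : Type) [AddCommGroup M] [Module K M] [FiniteDimensional K M]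
    (hdimM : Module.finrank K M = 3)
    (D : M → M) (hD : IsDiff d D)
    (β : N →ₗ[K] N →ₗ[K] M)
    (hβsym : ∀ x y, β x y = β y x)
    (hβcompat : ∀ x y, D (β x y) = β (DN x) y + β x (DN y))
    (hβspan : Submodule.span K {m : M | ∃ x y, β x y = m} = ⊤)
    -- the symmetric bilinear form on `M*` corresponding to `F = m₁₂·m₁₂ − m₁₁·m₂₂`
    (B : Module.Dual K M →ₗ[K] Module.Dual K M →ₗ[K] K)
    (hB : ∀ φ ψ, B φ ψ =
      2 * (φ (β (n 0) (n 1)) * ψ (β (n 0) (n 1)))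
        - φ (β (n 0) (n 0)) * ψ (β (n 1) (n 1))
        - φ (β (n 1) (n 1)) * ψ (β (n 0) (n 0))) :
    -- then `∂ F = 0`, `F` is nondegenerate and has a nonzero isotropic vector
    (∀ φ ψ, d (B φ ψ) = B (dualD hd hD φ) ψ + B φ (dualD hd hD ψ)) ∧
    (∀ φ, (∀ ψ, B φ ψ = 0) → φ = 0) ∧
    (∃ φ : Module.Dual K M, φ ≠ 0 ∧ B φ φ = 0) := by
  have hsub : ∀ a b, d (a - b) = d a - d b := by
    intro a b
    have h := hd.1 (a - b) b
    rw [sub_add_cancel] at h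
    rw [h]; ring
  have htr' : A 1 1 = - A 0 0 := by
    rw [Matrix.trace_fin_two] at htr
    linear_combination htr
  have h10 : β (n 1) (n 0) = β (n 0) (n 1) := hβsym _ _
  have hn0 : DN (n 0) = A 0 0 • n 0 + A 1 0 • n 1 := by
    rw [hA, Fin.sum_univ_two]
  have hn1 : DN (n 1) = A 0 1 • n 0 + A 1 1 • n 1 := by
    rw [hA, Fin.sum_univ_two]
  let v : Fin 3 → M := ![β (n 0) (n 0), β (n 0) (n 1), β (n 1) (n 1)]
  have hv : ∀ i, v i ∈ Submodule.span K (Set.range v) :=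
    fun i => Submodule.subset_span ⟨i, rfl⟩
  have hspan : ⊤ ≤ Submodule.span K (Set.range v) := by
    rw [← hβspan, Submodule.span_le]
    rintro m ⟨x, y, rfl⟩
    have hx := n.sum_repr x
    have hy := n.sum_repr y
    rw [Fin.sum_univ_two] at hx hy
    rw [← hx, ← hy]
    simp only [map_add, map_smul, LinearMap.add_apply, LinearMap.smul_apply, h10]
    have h0 : β (n 0) (n 0) ∈ Submodule.span K (Set.range v) := hv 0
    have h1 : β (n 0) (n 1) ∈ Submodule.span K (Set.range v) := hv 1
    have h2 : β (n 1) (n 1) ∈ Submodule.span K (Set.range v) := hv 2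
    refine Submodule.add_mem _ ?_ ?_ <;>
    simp only [smul_add] <;>
    refine Submodule.add_mem _ ?_ ?_ <;>
    refine Submodule.smul_mem _ _ (Submodule.smul_mem _ _ ?_) <;> assumption
  let b : Basis (Fin 3) K M :=
    basisOfTopLeSpanOfCardEqFinrank v hspan (by simp [hdimM])
  have hb : ∀ i, b i = v i := fun i => by
    simp [b]
  have hc : ∀ i j, b.coord i (v j) = if j = i then 1 else 0 := by
    intro i j
    rw [← hb, Basis.coord_apply, Basis.repr_self, Finsupp.single_apply]
  have c0 : ∀ i, b.coord i (β (n 0) (n 0)) = if (0 : Fin 3) = i then 1 else 0 :=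
    fun i => hc i 0
  have c1 : ∀ i, b.coord i (β (n 0) (n 1)) = if (1 : Fin 3) = i then 1 else 0 :=
    fun i => hc i 1
  have c2 : ∀ i, b.coord i (β (n 1) (n 1)) = if (2 : Fin 3) = i then 1 else 0 :=
    fun i => hc i 2
  refine ⟨?_, ?_, ?_⟩
  · intro φ ψ
    have hdual : ∀ (χ : Module.Dual K M) (m : M),
        dualD hd hD χ m = d (χ m) - χ (D m) := fun _ _ => rfl
    simp only [hB, hdual, hβcompat, hn0, hn1, map_add, map_smul, LinearMap.add_apply,
      LinearMap.smul_apply, h10, smul_eq_mul, htr', two_mul, hsub, hd.1, hd.2]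
    ring
  · intro φ hφ
    have e0 := hφ (b.coord 0)
    have e1 := hφ (b.coord 1)
    have e2 := hφ (b.coord 2)
    rw [hB, c0, c1, c2] at e0 e1 e2
    simp at e0 e1 e2
    refine b.ext fun i => ?_
    rw [hb]
    fin_cases i
    · simpa [v] using e2
    · simpa [v] using e1
    · simpa [v] using e0
  · refine ⟨b.coord 0, ?_, ?_⟩
    · intro h
      have := c0 0
      rw [h] at this
      simp at this
    · rw [hB, c0, c1, c2]
      simp
end

section
/- Let (K,d) be a differential field of characteristic 0 such that every nondegenerate symmetric bilinear form on a 3-dimensional K-vector space admits a nonzero isotropic vector. Let (M,∂) be an irreducible differential module over K of dimension 3 with det M = 1. Then M is isomorphic, as a differential module, to Sym²N for some differential module N of dimension 2 with det N = 1 if and only if Sym²M contains a nonzero element F with ∂F = 0. -/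
open Module

theorem IsDeriv.map_zero' {K : Type} [Field K] {d : K → K} (hd : IsDeriv d) : d 0 = 0 := by
  have := hd.1 0 0
  simpa using this

theorem IsDeriv.map_one' {K : Type} [Field K] {d : K → K} (hd : IsDeriv d) : d 1 = 0 := by
  have := hd.2 1 1
  simpa using this

theorem IsDeriv.map_neg' {K : Type} [Field K] {d : K → K} (hd : IsDeriv d) (a : K) :
    d (-a) = - d a := by
  have := hd.1 a (-a)
  rw [add_neg_cancel, hd.map_zero'] at this
  linear_combination -this

theorem IsDeriv.map_sub' {K : Type} [Field K] {d : K → K} (hd : IsDeriv d) (a b : K) :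
    d (a - b) = d a - d b := by
  rw [sub_eq_add_neg, hd.1, hd.map_neg', sub_eq_add_neg]

section aux
variable {K : Type} [Field K] {d : K → K} (hd : IsDeriv d)
  {M : Type} [AddCommGroup M] [Module K M] {D : M → M} (hD : IsDiff d D)

/-- The form is horizontal. -/
def Horiz (B : Module.Dual K M →ₗ[K] Module.Dual K M →ₗ[K] K) : Prop :=
  ∀ φ ψ, d (B φ ψ) = B (dualD hd hD φ) ψ + B φ (dualD hd hD ψ)

theorem dualD_coord (f : Basis (Fin 3) K M) (A : Matrix (Fin 3) (Fin 3) K)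
    (hA : ∀ i, D (f i) = ∑ j, A j i • f j) (i : Fin 3) :
    dualD hd hD (f.coord i) = - ∑ k, A i k • f.coord k := by
  refine f.ext fun l => ?_
  have h1 : d (f.coord i (f l)) = 0 := by
    rw [Basis.coord_apply, Basis.repr_self, Finsupp.single_apply]
    split_ifs
    · exact hd.map_one'
    · exact hd.map_zero'
  change d (f.coord i (f l)) - f.coord i (D (f l)) = _
  rw [h1, hA]
  simp [Finsupp.single_apply]

theorem horiz_coord {B : Module.Dual K M →ₗ[K] Module.Dual K M →ₗ[K] K}
    (hB : Horiz hd hD B) (f : Basis (Fin 3) K M) (A : Matrix (Fin 3) (Fin 3) K)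
    (hA : ∀ i, D (f i) = ∑ j, A j i • f j) (i j : Fin 3) :
    d (B (f.coord i) (f.coord j)) =
      -(∑ k, A i k * B (f.coord k) (f.coord j)) - ∑ k, A j k * B (f.coord i) (f.coord k) := by
  rw [hB, dualD_coord hd hD f A hA, dualD_coord hd hD f A hA]
  simp [Fin.sum_univ_three]
  ring

theorem det_const {B : Module.Dual K M →ₗ[K] Module.Dual K M →ₗ[K] K}
    (hs : ∀ φ ψ, B φ ψ = B ψ φ)
    (hB : Horiz hd hD B) (f : Basis (Fin 3) K M) (A : Matrix (Fin 3) (Fin 3) K)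
    (hA : ∀ i, D (f i) = ∑ j, A j i • f j) (htr : A.trace = 0) :
    d (Matrix.of fun i j => B (f.coord i) (f.coord j)).det = 0 := by
  have h := horiz_coord hd hD hB f A hA
  rw [Matrix.trace_fin_three] at htr
  simp only [Matrix.det_fin_three, Matrix.of_apply, hd.1, hd.2, hd.map_sub', h,
    Fin.sum_univ_three]
  rw [hs (f.coord 1) (f.coord 0), hs (f.coord 2) (f.coord 0), hs (f.coord 2) (f.coord 1)]
  generalize B (f.coord 0) (f.coord 0) = a
  generalize B (f.coord 0) (f.coord 1) = b
  generalize B (f.coord 0) (f.coord 2) = c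
  generalize B (f.coord 1) (f.coord 1) = e
  generalize B (f.coord 1) (f.coord 2) = g
  generalize B (f.coord 2) (f.coord 2) = k
  have h2 : A 2 2 = - A 0 0 - A 1 1 := by linear_combination htr
  rw [h2]
  ring

theorem nondeg [FiniteDimensional K M] (hirr : IsIrr K D)
    {B : Module.Dual K M →ₗ[K] Module.Dual K M →ₗ[K] K} (h0 : B ≠ 0)
    (hB : Horiz hd hD B) (φ : Module.Dual K M) (hφ : ∀ ψ, B φ ψ = 0) : φ = 0 := by
  rcases hirr.2 (LinearMap.ker B).dualCoannihilator (by
    intro m hm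
    rw [Submodule.mem_dualCoannihilator] at hm ⊢
    intro χ hχ
    have hχ' : ∀ ψ, B χ ψ = 0 := fun ψ => by
      rw [LinearMap.mem_ker] at hχ; rw [hχ]; rfl
    have h1 : dualD hd hD χ ∈ LinearMap.ker B := by
      rw [LinearMap.mem_ker]
      ext ψ
      have := hB χ ψ
      rw [hχ', hχ', hd.map_zero', add_zero] at this
      exact this.symm
    have h2 := hm _ h1
    change d (χ m) - χ (D m) = 0 at h2
    rw [hm χ hχ, hd.map_zero'] at h2
    simpa using h2) with h | h
  · exfalso
    apply h0
    rw [← LinearMap.ker_eq_top]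
    have := Subspace.dualCoannihilator_dualAnnihilator_eq (W := LinearMap.ker B)
    rw [h, Submodule.dualAnnihilator_bot] at this
    exact this.symm
  · ext m
    have hm : m ∈ (LinearMap.ker B).dualCoannihilator := by rw [h]; trivial
    rw [Submodule.mem_dualCoannihilator] at hm
    exact hm φ (by rw [LinearMap.mem_ker]; ext ψ; exact hφ ψ)

end aux

/-- Adapted basis for an isotropic form on a three-dimensional space. -/
theorem adapted {K : Type} [Field K] [CharZero K] {V : Type} [AddCommGroup V] [Module K V]
    [FiniteDimensional K V] (hV : finrank K V = 3) (B : V →ₗ[K] V →ₗ[K] K)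
    (hs : ∀ x y, B x y = B y x) (hn : ∀ x, (∀ y, B x y = 0) → x = 0)
    (x : V) (hx : x ≠ 0) (hxx : B x x = 0) :
    ∃ (v : Basis (Fin 3) K V) (q : K), q ≠ 0 ∧ B (v 0) (v 0) = 0 ∧ B (v 0) (v 1) = 0 ∧
      B (v 0) (v 2) = q ∧ B (v 1) (v 1) = -2 * q ∧ B (v 1) (v 2) = 0 ∧ B (v 2) (v 2) = 0 := by
  obtain ⟨y, hy⟩ : ∃ y, B x y ≠ 0 := by
    by_contra! h
    exact hx (hn x h)
  set z := y - (B y y / (2 * B x y)) • x with hz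
  have hxz : B x z = B x y := by simp [hz, hxx]
  have hzz : B z z = 0 := by
    simp [hz, hxx, hs y x]
    field_simp
    ring
  have hxz0 : B x z ≠ 0 := by rwa [hxz]
  clear_value z
  obtain ⟨w, hw, hw0⟩ : ∃ w ∈ LinearMap.ker ((B x).prod (B z)), w ≠ 0 := by
    apply Submodule.exists_mem_ne_zero_of_ne_bot
    apply LinearMap.ker_ne_bot_of_finrank_lt
    simp [hV]
  rw [LinearMap.mem_ker, LinearMap.prod_apply, Prod.mk_eq_zero] at hw
  obtain ⟨hxw, hzw⟩ := hw
  change B x w = 0 at hxw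
  change B z w = 0 at hzw
  have key : ∀ t : K, t ≠ 0 → LinearIndependent K ![x, w, t • z] := by
    intro t ht
    rw [Fintype.linearIndependent_iff]
    intro g hg
    simp only [Fin.sum_univ_three, Matrix.cons_val] at hg
    have e1 := congrArg (B x) hg
    have e2 := congrArg (B z) hg
    simp [hxx, hxw, hxz0, ht] at e1
    simp [hzz, hzw, hs z x, hxz0] at e2
    rw [e1, e2] at hg
    simp [hw0] at hg
    intro i
    fin_cases i
    · exact e2
    · exact hg
    · exact e1
  have hcard : Fintype.card (Fin 3) = finrank K V := by simp [hV]
  have hww : B w w ≠ 0 := by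
    intro hww
    apply hw0
    apply hn
    have : B w = 0 := by
      apply (basisOfLinearIndependentOfCardEqFinrank (key 1 one_ne_zero) hcard).ext
      intro i
      fin_cases i <;> simp [hww, hs w x, hs w z, hxw, hzw]
    intro y
    rw [this]; rfl
  have ht : -(B w w) / 2 / B x z ≠ 0 := by
    simp [hww, hxz0]
  refine ⟨basisOfLinearIndependentOfCardEqFinrank (key _ ht) hcard, -(B w w) / 2, ?_, ?_, ?_, ?_,
    ?_, ?_, ?_⟩
  · simp [hww]
  · simp [hxx]
  · simp [hxw]
  · simp; field_simp
  · simp; ring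
  · simp [hs w z, hzw]
  · simp [hzz]

/-- Rescaled adapted basis, with constant scaling factor. -/
theorem adapted_const {K : Type} [Field K] [CharZero K] {d : K → K} (hd : IsDeriv d)
    (hK : ∀ B : (Fin 3 → K) →ₗ[K] (Fin 3 → K) →ₗ[K] K,
      (∀ x y, B x y = B y x) → (∀ x, (∀ y, B x y = 0) → x = 0) →
      ∃ x, x ≠ 0 ∧ B x x = 0)
    {V : Type} [AddCommGroup V] [Module K V]
    [FiniteDimensional K V] (e : Basis (Fin 3) K V) (B : V →ₗ[K] V →ₗ[K] K)
    (hs : ∀ x y, B x y = B y x) (hn : ∀ x, (∀ y, B x y = 0) → x = 0)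
    (hdet : d (Matrix.of fun i j => B (e i) (e j)).det = 0) :
    ∃ (v : Basis (Fin 3) K V) (q : K), q ≠ 0 ∧ d q = 0 ∧
      B (v 0) (v 0) = 0 ∧ B (v 0) (v 1) = 0 ∧
      B (v 0) (v 2) = q ∧ B (v 1) (v 1) = -2 * q ∧ B (v 1) (v 2) = 0 ∧ B (v 2) (v 2) = 0 := by
  obtain ⟨x, hx, hxx⟩ := hK (B.compl₁₂ e.equivFun.symm.toLinearMap e.equivFun.symm.toLinearMap)
    (fun x y => hs _ _) (by
      intro x hx
      have : e.equivFun.symm x = 0 := hn _ (fun y => by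
        have := hx (e.equivFun y)
        simpa only [LinearMap.compl₁₂_apply, LinearEquiv.coe_coe,
          LinearEquiv.symm_apply_apply] using this)
      exact (LinearEquiv.map_eq_zero_iff _).1 this)
  have hV : finrank K V = 3 := by rw [finrank_eq_card_basis e]; simp
  obtain ⟨v, q, hq, h00, h01, h02, h11, h12, h22⟩ := adapted hV B hs hn (e.equivFun.symm x)
    (fun h => hx ((LinearEquiv.map_eq_zero_iff _).1 h)) hxx
  set F : Matrix (Fin 3) (Fin 3) K := Matrix.of fun i j => B (e i) (e j) with hF
  set P : Matrix (Fin 3) (Fin 3) K := e.toMatrix v with hP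
  have hm : P.transpose * F * P = Matrix.of fun i j => B (v i) (v j) := by
    ext i j
    conv_rhs => rw [Matrix.of_apply, ← e.sum_toMatrix_smul_self v i, ← e.sum_toMatrix_smul_self v j]
    simp only [Matrix.mul_apply, Fin.sum_univ_three, Matrix.transpose_apply, hF, hP,
      Matrix.of_apply, map_add, map_smul, LinearMap.add_apply, LinearMap.smul_apply, smul_eq_mul]
    ring
  have hdm : P.det * F.det * P.det = 2 * q ^ 3 := by
    have := congrArg Matrix.det hm
    rw [Matrix.det_mul, Matrix.det_mul, Matrix.det_transpose] at this
    rw [this, Matrix.det_fin_three]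
    simp only [Matrix.of_apply, hs (v 1) (v 0), hs (v 2) (v 0), hs (v 2) (v 1), h00, h01, h02,
      h11, h12, h22]
    ring
  have hne : P.det * F.det * P.det ≠ 0 := by
    rw [hdm]; simp [hq]
  have hP0 : P.det ≠ 0 := right_ne_zero_of_mul hne
  have hF0 : F.det ≠ 0 := right_ne_zero_of_mul (left_ne_zero_of_mul hne)
  have hs0 : q / P.det ≠ 0 := div_ne_zero hq hP0
  have hc : (q / P.det) * ((q / P.det) * q) = F.det / 2 := by
    field_simp
    linear_combination -hdm
  refine ⟨v.isUnitSMul (w := fun _ => q / P.det) (fun _ => hs0.isUnit), F.det / 2, ?_, ?_,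
    ?_, ?_, ?_, ?_, ?_, ?_⟩
  · simp [hF0]
  · have h2 := hd.1 (F.det / 2) (F.det / 2)
    rw [add_halves, hdet] at h2
    have : 2 * d (F.det / 2) = 0 := by linear_combination -h2
    simpa using this
  all_goals simp only [Basis.isUnitSMul_apply, map_smul, LinearMap.smul_apply, smul_eq_mul,
      h00, h01, h02, h11, h12, h22, mul_zero]
  · exact hc
  · linear_combination (-2) * hc

theorem backward {K : Type} [Field K] [CharZero K] (d : K → K) (hd : IsDeriv d)
    (hK : ∀ B : (Fin 3 → K) →ₗ[K] (Fin 3 → K) →ₗ[K] K,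
      (∀ x y, B x y = B y x) → (∀ x, (∀ y, B x y = 0) → x = 0) →
      ∃ x, x ≠ 0 ∧ B x x = 0)
    (M : Type) [AddCommGroup M] [Module K M] [FiniteDimensional K M]
    (D : M → M) (hD : IsDiff d D) (hirr : IsIrr K D) (hdet : TraceZero K D 3)
    (B : Module.Dual K M →ₗ[K] Module.Dual K M →ₗ[K] K) (h0 : B ≠ 0)
    (hs : ∀ φ ψ, B φ ψ = B ψ φ) (hB : Horiz hd hD B) :
    (∃ DN : (Fin 2 → K) → (Fin 2 → K), IsDiff d DN ∧ TraceZero K DN 2 ∧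
      ∃ β : (Fin 2 → K) →ₗ[K] (Fin 2 → K) →ₗ[K] M,
        (∀ x y, β x y = β y x) ∧
        (∀ x y, D (β x y) = β (DN x) y + β x (DN y)) ∧
        Submodule.span K {m : M | ∃ x y, β x y = m} = ⊤) := by
  obtain ⟨b, A0, hA0, htr⟩ := hdet
  have hdc := det_const hd hD hs hB b A0 hA0 htr
  obtain ⟨v, q, hq, hdq, h00, h01, h02, h11, h12, h22⟩ := adapted_const hd hK b.dualBasis B hs
    (nondeg hd hD hirr h0 hB) (by simpa using hdc)
  let f : Basis (Fin 3) K M := v.dualBasis.map (evalEquiv K M).symm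
  have hvf : ∀ i j, v i (f j) = if i = j then 1 else 0 := by
    intro i j
    have : v i (f j) = (evalEquiv K M (f j)) (v i) := by simp
    rw [this]
    simp only [f, Basis.map_apply, LinearEquiv.apply_symm_apply]
    rw [Basis.dualBasis_apply_self]
  have hcv : ∀ i, f.coord i = v i := by
    intro i
    refine f.ext fun j => ?_
    rw [hvf, Basis.coord_apply, Basis.repr_self, Finsupp.single_apply]
    simp [eq_comm]
  have hA : ∀ i, D (f i) = ∑ j, (Matrix.of fun j i => f.repr (D (f i)) j) j i • f j := by
    intro i
    simp only [Matrix.of_apply]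
    exact (f.sum_repr _).symm
  generalize (Matrix.of fun j i => f.repr (D (f i)) j) = A at hA
  have h := horiz_coord hd hD hB f A hA
  simp only [hcv, Fin.sum_univ_three] at h
  clear_value f
  have k00 := h 0 0
  have k01 := h 0 1
  have k02 := h 0 2
  have k11 := h 1 1
  have k12 := h 1 2
  have k22 := h 2 2
  have hd2 : d (-2 * q) = 0 := by
    have e : -2 * q = -(q + q) := by ring
    rw [e, hd.map_neg', hd.1, hdq]; simp
  simp only [hs (v 1) (v 0), hs (v 2) (v 0), hs (v 2) (v 1), h00, h01, h02, h11, h12, h22,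
    hd.map_zero', hdq, hd2, mul_zero, add_zero, zero_add] at k00 k01 k02 k11 k12 k22
  have a02 : A 0 2 = 0 := by
    apply mul_right_cancel₀ hq; linear_combination (1/2) * k00
  have a01 : A 1 2 = 2 * A 0 1 := by
    apply mul_right_cancel₀ hq; linear_combination  k01
  have a00 : A 2 2 = - A 0 0 := by
    apply mul_right_cancel₀ hq; linear_combination  k02
  have a11 : A 1 1 = 0 := by
    apply mul_right_cancel₀ hq; linear_combination (-1/4) * k11
  have a12 : A 1 0 = 2 * A 2 1 := by
    apply mul_right_cancel₀ hq; linear_combination  k12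
  have a20 : A 2 0 = 0 := by
    apply mul_right_cancel₀ hq; linear_combination (1/2) * k22
  have D0 := hA 0
  have D1 := hA 1
  have D2 := hA 2
  simp only [Fin.sum_univ_three, a02, a01, a00, a11, a12, a20, zero_smul, zero_add, add_zero]
    at D0 D1 D2
  generalize A 0 0 = a at *
  generalize A 2 1 = c at *
  generalize A 0 1 = e at *
  refine ⟨fun x => ![d (x 0) + a / 2 * x 0 + e * x 1, d (x 1) + c * x 0 - a / 2 * x 1],
    ⟨?_, ?_⟩, ⟨Pi.basisFun K (Fin 2), !![a / 2, e; c, - (a / 2)], ?_, ?_⟩,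
    LinearMap.mk₂ K (fun x y => (x 0 * y 0) • f 0 + (x 0 * y 1 + x 1 * y 0) • f 1
      + (x 1 * y 1) • f 2) ?_ ?_ ?_ ?_, ?_, ?_, ?_⟩
  · intro x y
    ext i
    fin_cases i <;> simp [hd.1] <;> ring
  · intro r x
    ext i
    fin_cases i <;> simp [hd.2] <;> ring
  · intro i
    ext j
    fin_cases i <;> fin_cases j <;> simp [hd.map_zero', hd.map_one']
  · simp [Matrix.trace_fin_two]
  · intro x x' y
    simp only [Pi.add_apply]
    module
  · intro r x y
    simp only [Pi.smul_apply, smul_eq_mul]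
    module
  · intro x x' y
    simp only [Pi.add_apply]
    module
  · intro r x y
    simp only [Pi.smul_apply, smul_eq_mul]
    module
  · intro x y
    simp only [LinearMap.mk₂_apply]
    module
  · intro x y
    simp only [LinearMap.mk₂_apply, hD.1, hD.2, hd.1, hd.2, D0, D1, D2, Matrix.cons_val_zero,
      Matrix.cons_val_one]
    module
  · rw [eq_top_iff, ← f.span_eq]
    apply Submodule.span_le.2
    rintro _ ⟨i, rfl⟩
    apply Submodule.subset_span
    fin_cases i
    · exact ⟨![1, 0], ![1, 0], by simp⟩
    · exact ⟨![1, 0], ![0, 1], by simp⟩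
    · exact ⟨![0, 1], ![0, 1], by simp⟩

theorem forward {K : Type} [Field K] [CharZero K] (d : K → K) (hd : IsDeriv d)
    (M : Type) [AddCommGroup M] [Module K M] [FiniteDimensional K M]
    (hdim : Module.finrank K M = 3)
    (D : M → M) (hD : IsDiff d D)
    (DN : (Fin 2 → K) → (Fin 2 → K)) (htr : TraceZero K DN 2)
    (β : (Fin 2 → K) →ₗ[K] (Fin 2 → K) →ₗ[K] M)
    (hs : ∀ x y, β x y = β y x)
    (hβ : ∀ x y, D (β x y) = β (DN x) y + β x (DN y))
    (hspan : Submodule.span K {m : M | ∃ x y, β x y = m} = ⊤) :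
    ∃ B : Module.Dual K M →ₗ[K] Module.Dual K M →ₗ[K] K, B ≠ 0 ∧
      (∀ φ ψ, B φ ψ = B ψ φ) ∧ Horiz hd hD B := by
  obtain ⟨b, A, hA, ht⟩ := htr
  rw [Matrix.trace_fin_two] at ht
  have h11 : A 1 1 = - A 0 0 := by linear_combination ht
  have E0 := hA 0
  have E1 := hA 1
  simp only [Fin.sum_univ_two, h11] at E0 E1
  have D0 : D (β (b 0) (b 0)) = (2 * A 0 0) • β (b 0) (b 0) + (2 * A 1 0) • β (b 0) (b 1) := by
    rw [hβ, E0]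
    simp only [map_add, map_smul, LinearMap.add_apply, LinearMap.smul_apply, hs (b 1) (b 0)]
    module
  have D1 : D (β (b 0) (b 1)) = A 0 1 • β (b 0) (b 0) + A 1 0 • β (b 1) (b 1) := by
    rw [hβ, E0, E1]
    simp only [map_add, map_smul, LinearMap.add_apply, LinearMap.smul_apply, hs (b 1) (b 0)]
    module
  have D2 : D (β (b 1) (b 1)) = (2 * A 0 1) • β (b 0) (b 1) - (2 * A 0 0) • β (b 1) (b 1) := by
    rw [hβ, E1]
    simp only [map_add, map_smul, LinearMap.add_apply, LinearMap.smul_apply, hs (b 1) (b 0)]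
    module
  have hsp : ⊤ ≤ Submodule.span K
      (Set.range ![β (b 0) (b 0), β (b 0) (b 1), β (b 1) (b 1)]) := by
    rw [← hspan]
    apply Submodule.span_le.2
    rintro _ ⟨x, y, rfl⟩
    have m0 : β (b 0) (b 0) ∈ Submodule.span K
      (Set.range ![β (b 0) (b 0), β (b 0) (b 1), β (b 1) (b 1)]) :=
      Submodule.subset_span ⟨0, rfl⟩
    have m1 : β (b 0) (b 1) ∈ Submodule.span K
      (Set.range ![β (b 0) (b 0), β (b 0) (b 1), β (b 1) (b 1)]) :=
      Submodule.subset_span ⟨1, rfl⟩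
    have m2 : β (b 1) (b 1) ∈ Submodule.span K
      (Set.range ![β (b 0) (b 0), β (b 0) (b 1), β (b 1) (b 1)]) :=
      Submodule.subset_span ⟨2, rfl⟩
    rw [SetLike.mem_coe, ← b.sum_repr x, ← b.sum_repr y]
    simp only [Fin.sum_univ_two, map_add, map_smul, LinearMap.add_apply, LinearMap.smul_apply,
      hs (b 1) (b 0)]
    refine add_mem ?_ ?_ <;>
      refine (Submodule.smul_mem _ _ (add_mem (Submodule.smul_mem _ _ ?_)
        (Submodule.smul_mem _ _ ?_))) <;> assumption
  let f := basisOfTopLeSpanOfCardEqFinrank _ hsp (by simp [hdim])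
  have f0 : β (b 0) (b 0) = f 0 := by simp [f]
  have f1 : β (b 0) (b 1) = f 1 := by simp [f]
  have f2 : β (b 1) (b 1) = f 2 := by simp [f]
  clear_value f
  rw [f0, f1] at D0
  rw [f0, f1, f2] at D1
  rw [f1, f2] at D2
  refine ⟨LinearMap.mk₂ K (fun φ ψ => φ (f 0) * ψ (f 2) + φ (f 2) * ψ (f 0)
    - 2 * (φ (f 1) * ψ (f 1))) ?_ ?_ ?_ ?_, ?_, ?_, ?_⟩
  · intros; simp only [LinearMap.add_apply]; ring
  · intros; simp only [LinearMap.smul_apply, smul_eq_mul]; ring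
  · intros; simp only [LinearMap.add_apply]; ring
  · intros; simp only [LinearMap.smul_apply, smul_eq_mul]; ring
  · intro h
    have := LinearMap.congr_fun (LinearMap.congr_fun h (f.coord 0)) (f.coord 2)
    simp at this
  · intro φ ψ
    simp only [LinearMap.mk₂_apply]; ring
  · intro φ ψ
    have e : ∀ (χ : Module.Dual K M) m, dualD hd hD χ m = d (χ m) - χ (D m) := fun _ _ => rfl
    have d2 : d 2 = 0 := by
      rw [← one_add_one_eq_two, hd.1, hd.map_one', add_zero]
    simp only [LinearMap.mk₂_apply, e, D0, D1, D2, hd.1, hd.2, hd.map_sub', d2, map_add, map_sub,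
      map_smul, smul_eq_mul]
    ring

/-- **Test.** Over a differential field `K` (of characteristic zero) in
which every nondegenerate symmetric bilinear form in `3` variables has a nontrivial
zero, an irreducible `3`-dimensional differential module `M` with `det M = 1` is
isomorphic to `Sym² N` for some `2`-dimensional differential module `N` with
`det N = 1` if and only if `Sym² M` contains a nonzero `F` with `∂ F = 0`. -/
theorem stmt2 {K : Type} [Field K] [CharZero K] (d : K → K) (hd : IsDeriv d)
    -- every nondegenerate symmetric bilinear form on a 3-dimensional K-vector space
    -- admits a nonzero isotropic vector
    (hK : ∀ B : (Fin 3 → K) →ₗ[K] (Fin 3 → K) →ₗ[K] K,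
      (∀ x y, B x y = B y x) → (∀ x, (∀ y, B x y = 0) → x = 0) →
      ∃ x, x ≠ 0 ∧ B x x = 0)
    (M : Type) [AddCommGroup M] [Module K M] [FiniteDimensional K M]
    (hdim : Module.finrank K M = 3)
    (D : M → M) (hD : IsDiff d D) (hirr : IsIrr K D) (hdet : TraceZero K D 3) :
    -- `M ≅ Sym² N` for some differential module `N` of dimension 2 with `det N = 1` ...
    (∃ DN : (Fin 2 → K) → (Fin 2 → K), IsDiff d DN ∧ TraceZero K DN 2 ∧
      ∃ β : (Fin 2 → K) →ₗ[K] (Fin 2 → K) →ₗ[K] M,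
        (∀ x y, β x y = β y x) ∧
        (∀ x y, D (β x y) = β (DN x) y + β x (DN y)) ∧
        Submodule.span K {m : M | ∃ x y, β x y = m} = ⊤)
    ↔
    -- ... iff `Sym² M` contains a nonzero element `F` (viewed as a symmetric bilinear
    -- form `B` on the dual of `M`) with `∂ F = 0`.
    (∃ B : Module.Dual K M →ₗ[K] Module.Dual K M →ₗ[K] K, B ≠ 0 ∧
      (∀ φ ψ, B φ ψ = B ψ φ) ∧
      (∀ φ ψ, d (B φ ψ) = B (dualD hd hD φ) ψ + B φ (dualD hd hD ψ))) := by
  constructor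
  · rintro ⟨DN, -, htr, β, hs, hβ, hspan⟩
    exact forward d hd M hdim D hD DN htr β hs hβ hspan
  · rintro ⟨B, h0, hs, hB⟩
    exact backward d hd hK M D hD hirr hdet B h0 hs hB
end

section
/- Let (K,d) be a differential field of characteristic 0, let (M,∂) be a differential module over K, and let f : M → M be a K-linear map with f ∘ ∂ = ∂ ∘ f. Then every coefficient of the characteristic polynomial of f lies in the field of constants C = {a ∈ K : d(a) = 0}. -/
open Module

/-- The ring homomorphism `a ↦ a + d(a) ε` into the dual numbers. -/
noncomputable def derivHom {K : Type} [Field K] {d : K → K} (hd : IsDeriv d) :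
    K →+* TrivSqZeroExt K K where
  toFun a := (a, d a)
  map_one' := by
    have h := hd.2 1 1
    simp only [mul_one, one_mul] at h
    have h1 : d 1 = 0 := by simpa using h
    ext
    · rfl
    · exact h1
  map_mul' a b := by
    ext
    · rfl
    · change d (a * b) = a • d b + MulOpposite.op b • d a
      rw [hd.2]
      rw [op_smul_eq_smul, smul_eq_mul, smul_eq_mul]
      ring
  map_zero' := by
    have h := hd.1 0 0
    simp only [add_zero] at h
    have h1 : d 0 = 0 := by simpa using h
    ext
    · rfl
    · exact h1
  map_add' a b := by
    ext
    · rfl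
    · exact hd.1 a b

theorem isDiff_sum {K : Type} [Field K] {d : K → K} {M : Type} [AddCommGroup M] [Module K M]
    {D : M → M} (hD : IsDiff d D) {ι : Type} (s : Finset ι) (c : ι → K) (v : ι → M) :
    D (∑ j ∈ s, c j • v j) = ∑ j ∈ s, (d (c j) • v j + c j • D (v j)) := by
  let D' : M →+ M := AddMonoidHom.mk' D hD.1
  have : D' (∑ j ∈ s, c j • v j) = ∑ j ∈ s, D' (c j • v j) := map_sum _ _ _
  refine this.trans (Finset.sum_congr rfl fun j _ => hD.2 _ _)

theorem charpoly_const {K : Type} [Field K] {d : K → K} (hd : IsDeriv d) {n : ℕ}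
    (F A : Matrix (Fin n) (Fin n) K) (h : F.map d + A * F = F * A) (i : ℕ) :
    d (F.charpoly.coeff i) = 0 := by
  let E : Matrix (Fin n) (Fin n) (TrivSqZeroExt K K) := A.map TrivSqZeroExt.inr
  have hE : E * E = 0 := by
    ext i j
    · simp [E, Matrix.mul_apply]
    · simp [E, Matrix.mul_apply]
  let U : (Matrix (Fin n) (Fin n) (TrivSqZeroExt K K))ˣ :=
    ⟨1 - E, 1 + E, by noncomm_ring; simp [hE], by noncomm_ring; simp [hE]⟩
  let B := F.map (TrivSqZeroExt.inlHom K K)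
  have key : U.val * B = F.map (derivHom hd) * U.val := by
    change (1 - E) * B = F.map (derivHom hd) * (1 - E)
    rw [sub_mul, mul_sub, one_mul, mul_one]
    ext i j
    · simp [E, B, Matrix.mul_apply, TrivSqZeroExt.fst_sum, derivHom]
      rfl
    · have := congrFun (congrFun h i) j
      simp only [Matrix.add_apply, Matrix.mul_apply, Matrix.map_apply] at this
      have e : ∀ x, (derivHom hd x).fst = x := fun _ => rfl
      have e2 : ∀ x, (derivHom hd x).snd = d x := fun _ => rfl
      simp [E, B, Matrix.mul_apply, TrivSqZeroExt.snd_sum, e, e2]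
      simp only [mul_comm] at this ⊢
      linear_combination -this
  have h2 : U.val * B * U⁻¹.val = F.map (derivHom hd) := by
    rw [key, mul_assoc, Units.mul_inv, mul_one]
  have h3 := Matrix.charpoly_units_conj U B
  rw [← Matrix.coe_units_inv, h2, Matrix.charpoly_map, Matrix.charpoly_map] at h3
  have h4 := congrArg (fun p => (p.coeff i).snd) h3
  simp only [Polynomial.coeff_map] at h4
  exact h4

/-- If `f : M → M` is `K`-linear and commutes with `∂`, then all the
coefficients of its characteristic polynomial are constants of the differential
field `(K, d)`. -/
theorem stmt8 {K : Type} [Field K] [CharZero K] (d : K → K) (hd : IsDeriv d)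
    (M : Type) [AddCommGroup M] [Module K M] [FiniteDimensional K M]
    (D : M → M) (hD : IsDiff d D)
    (f : M →ₗ[K] M) (hf : ∀ m, f (D m) = D (f m)) :
    ∀ i, d ((LinearMap.charpoly f).coeff i) = 0 := by
  intro i
  let b := Module.finBasis K M
  rw [← LinearMap.charpoly_toMatrix f b]
  refine charpoly_const hd _ (Matrix.of fun j i => b.repr (D (b i)) j) ?_ i
  have hb : ∀ m, D m = ∑ j, (d (b.repr m j) • b j + b.repr m j • D (b j)) := fun m => by
    conv_lhs => rw [← b.sum_repr m]
    exact isDiff_sum hD _ _ _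
  ext k l
  have h : b.repr (f (D (b l))) k = b.repr (D (f (b l))) k := by rw [hf]
  rw [hb (f (b l)), ← b.sum_repr (D (b l))] at h
  simp only [map_sum, map_add, map_smul, Finsupp.coe_finset_sum, Finset.sum_apply,
    Finsupp.add_apply, Finsupp.smul_apply, smul_eq_mul, Finset.sum_add_distrib,
    Basis.repr_self, Finsupp.single_apply, mul_ite, mul_one, mul_zero,
    Finset.sum_ite_eq', Finset.mem_univ, if_true] at h
  simp only [Matrix.add_apply, Matrix.mul_apply, Matrix.map_apply, LinearMap.toMatrix_apply,
    Matrix.of_apply]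
  simp only [mul_comm] at h ⊢
  exact h.symm
end

section
/- Let V be a 2-dimensional ℂ-vector space and let g ∈ GL(V⊗V) be an automorphism mapping the set of decomposable tensors {v⊗w : v, w ∈ V} bijectively onto itself. Then there exist A, B ∈ GL(V) such that either g = A⊗B or g = (A⊗B) ∘ flip. -/
open scoped TensorProduct

section Helpers

variable {V : Type} [AddCommGroup V] [Module ℂ V]

/-- The determinant of two vectors with respect to a basis. -/
noncomputable def wdg (e : Module.Basis (Fin 2) ℂ V) (x y : V) : ℂ :=
  e.repr x 0 * e.repr y 1 - e.repr x 1 * e.repr y 0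

lemma wdg_of_pure (e : Module.Basis (Fin 2) ℂ V) {a b c d x y : V}
    (h : a ⊗ₜ[ℂ] b + c ⊗ₜ[ℂ] d = x ⊗ₜ[ℂ] y) : wdg e a c * wdg e b d = 0 := by
  have key : ∀ i j, e.repr a i * e.repr b j + e.repr c i * e.repr d j
      = e.repr x i * e.repr y j := by
    intro i j
    have := congrArg (fun t => (e.tensorProduct e).repr t (i, j)) h
    simp [Module.Basis.tensorProduct_repr_tmul_apply] at this
    linear_combination this
  have h00 := key 0 0
  have h01 := key 0 1
  have h10 := key 1 0
  have h11 := key 1 1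
  unfold wdg
  generalize e.repr a 0 = a0 at *
  generalize e.repr a 1 = a1 at *
  generalize e.repr b 0 = b0 at *
  generalize e.repr b 1 = b1 at *
  generalize e.repr c 0 = c0 at *
  generalize e.repr c 1 = c1 at *
  generalize e.repr d 0 = d0 at *
  generalize e.repr d 1 = d1 at *
  generalize e.repr x 0 = x0 at *
  generalize e.repr x 1 = x1 at *
  generalize e.repr y 0 = y0 at *
  generalize e.repr y 1 = y1 at *
  have : (a0 * b0 + c0 * d0) * (a1 * b1 + c1 * d1)
      - (a0 * b1 + c0 * d1) * (a1 * b0 + c1 * d0) = 0 := by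
    rw [h00, h01, h10, h11]; ring
  linear_combination this

lemma smul_of_wdg (e : Module.Basis (Fin 2) ℂ V) {a c : V} (ha : a ≠ 0)
    (h : wdg e a c = 0) : ∃ k : ℂ, c = k • a := by
  unfold wdg at h
  by_cases h0 : e.repr a 0 = 0
  · have h1 : e.repr a 1 ≠ 0 := by
      intro h1
      apply ha
      apply e.ext_elem
      intro i
      fin_cases i <;> simp [h0, h1]
    refine ⟨e.repr c 1 / e.repr a 1, e.ext_elem fun i => ?_⟩
    fin_cases i
    · simp [h0] at h ⊢
      exact h.resolve_left h1
    · simp; field_simp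
  · refine ⟨e.repr c 0 / e.repr a 0, e.ext_elem fun i => ?_⟩
    fin_cases i
    · simp; field_simp
    · simp; field_simp; linear_combination h

lemma li_of_wdg (e : Module.Basis (Fin 2) ℂ V) {a c : V} (h : wdg e a c ≠ 0) :
    LinearIndependent ℂ ![a, c] := by
  rw [LinearIndependent.pair_iff]
  intro s t hst
  have h0 := congrArg (fun v => e.repr v 0) hst
  have h1 := congrArg (fun v => e.repr v 1) hst
  simp at h0 h1
  constructor
  · refine (mul_eq_zero.1 (?_ : s * wdg e a c = 0)).resolve_right h
    unfold wdg; linear_combination e.repr c 1 * h0 - e.repr c 0 * h1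
  · refine (mul_eq_zero.1 (?_ : t * wdg e a c = 0)).resolve_right h
    unfold wdg; linear_combination e.repr a 0 * h1 - e.repr a 1 * h0

lemma exists_equiv (e : Module.Basis (Fin 2) ℂ V) {a c : V} (h : wdg e a c ≠ 0) :
    ∃ A : V ≃ₗ[ℂ] V, A (e 0) = a ∧ A (e 1) = c := by
  have hd : Fintype.card (Fin 2) = Module.finrank ℂ V :=
    (Module.finrank_eq_card_basis e).symm
  refine ⟨e.equiv (basisOfLinearIndependentOfCardEqFinrank (li_of_wdg e h) hd)
    (Equiv.refl _), ?_, ?_⟩ <;> simp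

lemma main_case (e : Module.Basis (Fin 2) ℂ V) (g : (V ⊗[ℂ] V) ≃ₗ[ℂ] (V ⊗[ℂ] V))
    (hP : ∀ v w : V, ∃ x y : V, g (v ⊗ₜ[ℂ] w) = x ⊗ₜ[ℂ] y)
    (hQ1 : ∀ x y : V, g (e 0 ⊗ₜ[ℂ] e 0) + g (e 1 ⊗ₜ[ℂ] e 1) ≠ x ⊗ₜ[ℂ] y)
    (hQ2 : ∀ x y : V, g (e 0 ⊗ₜ[ℂ] e 1) + g (e 1 ⊗ₜ[ℂ] e 0) ≠ x ⊗ₜ[ℂ] y)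
    (a b b1 : V) (h00 : g (e 0 ⊗ₜ[ℂ] e 0) = a ⊗ₜ[ℂ] b)
    (h01 : g (e 0 ⊗ₜ[ℂ] e 1) = a ⊗ₜ[ℂ] b1) :
    ∃ A B : V ≃ₗ[ℂ] V, (g : V ⊗[ℂ] V →ₗ[ℂ] V ⊗[ℂ] V)
          = TensorProduct.map A.toLinearMap B.toLinearMap := by
  obtain ⟨c, d, h10⟩ := hP (e 1) (e 0)
  obtain ⟨p, q, h11⟩ := hP (e 1) (e 1)
  rw [h00, h11] at hQ1
  rw [h01, h10] at hQ2
  have ha : a ≠ 0 := by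
    rintro rfl
    exact hQ1 p q (by simp)
  have hb : b ≠ 0 := by
    rintro rfl
    exact hQ1 p q (by simp)
  have hb1 : b1 ≠ 0 := by
    rintro rfl
    exact hQ2 c d (by simp)
  have hc : c ≠ 0 := by
    rintro rfl
    exact hQ2 a b1 (by simp)
  have hac : wdg e a c ≠ 0 := by
    intro h
    obtain ⟨k, rfl⟩ := smul_of_wdg e ha h
    exact hQ2 a (b1 + k • d) (by rw [TensorProduct.tmul_add, TensorProduct.smul_tmul])
  have hbd : wdg e b d = 0 := by
    obtain ⟨x, y, hxy⟩ := hP (e 0 + e 1) (e 0)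
    rw [TensorProduct.add_tmul, map_add, h00, h10] at hxy
    exact (mul_eq_zero.1 (wdg_of_pure e hxy)).resolve_left hac
  obtain ⟨k, rfl⟩ := smul_of_wdg e hb hbd
  have hbq : wdg e b q ≠ 0 := by
    intro h
    obtain ⟨l, rfl⟩ := smul_of_wdg e hb h
    exact hQ1 (a + l • p) b (by rw [TensorProduct.add_tmul, TensorProduct.smul_tmul])
  rw [← TensorProduct.smul_tmul] at h10 hQ2
  have hkc : k • c ≠ 0 := by
    intro h
    exact hQ2 a b1 (by simp [h])
  have hkac : wdg e a (k • c) ≠ 0 := by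
    intro h
    obtain ⟨l, hl⟩ := smul_of_wdg e ha h
    exact hQ2 a (b1 + l • b) (by rw [hl, TensorProduct.tmul_add, TensorProduct.smul_tmul])
  generalize k • c = cc at *
  have hcp : wdg e cc p = 0 := by
    obtain ⟨x, y, hxy⟩ := hP (e 1) (e 0 + e 1)
    rw [TensorProduct.tmul_add, map_add, h10, h11] at hxy
    exact (mul_eq_zero.1 (wdg_of_pure e hxy)).resolve_right hbq
  obtain ⟨l, rfl⟩ := smul_of_wdg e hkc hcp
  rw [TensorProduct.smul_tmul] at h11
  have hbb : wdg e b b1 ≠ 0 := by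
    intro h
    obtain ⟨m, rfl⟩ := smul_of_wdg e hb h
    exact hQ2 (m • a + cc) b (by rw [TensorProduct.add_tmul, TensorProduct.smul_tmul])
  have hbq1 : wdg e b1 (l • q) = 0 := by
    obtain ⟨x, y, hxy⟩ := hP (e 0 + e 1) (e 1)
    rw [TensorProduct.add_tmul, map_add, h01, h11] at hxy
    exact (mul_eq_zero.1 (wdg_of_pure e hxy)).resolve_left hkac
  obtain ⟨m, hm⟩ := smul_of_wdg e hb1 hbq1
  rw [hm] at h11
  have hm1 : m = 1 := by
    obtain ⟨x, y, hxy⟩ := hP (e 0 + e 1) (e 0 + e 1)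
    rw [TensorProduct.add_tmul, TensorProduct.tmul_add, TensorProduct.tmul_add,
      map_add, map_add, map_add, h00, h01, h10, h11, ← TensorProduct.tmul_add,
      ← TensorProduct.tmul_add] at hxy
    have h := (mul_eq_zero.1 (wdg_of_pure e hxy)).resolve_left hkac
    have h2 : (m - 1) * wdg e b b1 = 0 := by
      rw [← h]
      simp [wdg]
      ring
    exact sub_eq_zero.1 ((mul_eq_zero.1 h2).resolve_right hbb)
  rw [hm1, one_smul] at h11
  obtain ⟨A, hA0, hA1⟩ := exists_equiv e hkac
  obtain ⟨B, hB0, hB1⟩ := exists_equiv e hbb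
  refine ⟨A, B, (e.tensorProduct e).ext ?_⟩
  rintro ⟨i, j⟩
  fin_cases i <;> fin_cases j <;> simp [Module.Basis.tensorProduct_apply, *]

end Helpers

/-- If `V` is a `2`-dimensional complex vector space and
`g ∈ GL(V ⊗ V)` maps the set of decomposable tensors bijectively onto itself, then
`g = A ⊗ B` or `g = (A ⊗ B) ∘ flip` for some `A, B ∈ GL(V)`. -/
theorem stmt13 (V : Type) [AddCommGroup V] [Module ℂ V] [FiniteDimensional ℂ V]
    (hdim : Module.finrank ℂ V = 2)
    (g : (V ⊗[ℂ] V) ≃ₗ[ℂ] (V ⊗[ℂ] V))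
    (hg : (fun t => g t) '' {t : V ⊗[ℂ] V | ∃ v w : V, t = v ⊗ₜ[ℂ] w}
      = {t : V ⊗[ℂ] V | ∃ v w : V, t = v ⊗ₜ[ℂ] w}) :
    ∃ A B : V ≃ₗ[ℂ] V,
      (g : V ⊗[ℂ] V →ₗ[ℂ] V ⊗[ℂ] V)
          = TensorProduct.map A.toLinearMap B.toLinearMap ∨
      (g : V ⊗[ℂ] V →ₗ[ℂ] V ⊗[ℂ] V)
          = (TensorProduct.map A.toLinearMap B.toLinearMap) ∘ₗ
              (TensorProduct.comm ℂ V V).toLinearMap := by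
  classical
  have e : Module.Basis (Fin 2) ℂ V := Module.finBasisOfFinrankEq ℂ V hdim
  have hP : ∀ v w : V, ∃ x y : V, g (v ⊗ₜ[ℂ] w) = x ⊗ₜ[ℂ] y := by
    intro v w
    have : g (v ⊗ₜ[ℂ] w) ∈ {t : V ⊗[ℂ] V | ∃ v w : V, t = v ⊗ₜ[ℂ] w} := by
      rw [← hg]
      exact ⟨_, ⟨v, w, rfl⟩, rfl⟩
    exact this
  have hR : ∀ t : V ⊗[ℂ] V, ∀ x y : V, g t = x ⊗ₜ[ℂ] y → ∃ v w : V, t = v ⊗ₜ[ℂ] w := by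
    intro t x y h
    have : g t ∈ {t : V ⊗[ℂ] V | ∃ v w : V, t = v ⊗ₜ[ℂ] w} := ⟨x, y, h⟩
    rw [← hg] at this
    obtain ⟨s, hs, hst⟩ := this
    rw [← g.injective hst]
    exact hs
  have hQ1 : ∀ x y : V, g (e 0 ⊗ₜ[ℂ] e 0) + g (e 1 ⊗ₜ[ℂ] e 1) ≠ x ⊗ₜ[ℂ] y := by
    intro x y h
    rw [← map_add] at h
    obtain ⟨v, w, hvw⟩ := hR _ x y h
    have := wdg_of_pure e hvw
    simp [wdg] at this
  have hQ2 : ∀ x y : V, g (e 0 ⊗ₜ[ℂ] e 1) + g (e 1 ⊗ₜ[ℂ] e 0) ≠ x ⊗ₜ[ℂ] y := by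
    intro x y h
    rw [← map_add] at h
    obtain ⟨v, w, hvw⟩ := hR _ x y h
    have := wdg_of_pure e hvw
    simp [wdg] at this
  obtain ⟨a, b, h00⟩ := hP (e 0) (e 0)
  obtain ⟨a1, b1, h01⟩ := hP (e 0) (e 1)
  obtain ⟨c, d, h10⟩ := hP (e 1) (e 0)
  obtain ⟨p, q, h11⟩ := hP (e 1) (e 1)
  have ha : a ≠ 0 := by
    rintro rfl
    exact hQ1 p q (by simp [h00, h11])
  have hb : b ≠ 0 := by
    rintro rfl
    exact hQ1 p q (by simp [h00, h11])
  by_cases hw : wdg e a a1 = 0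
  · obtain ⟨k, rfl⟩ := smul_of_wdg e ha hw
    rw [TensorProduct.smul_tmul] at h01
    obtain ⟨A, B, h⟩ := main_case e g hP hQ1 hQ2 a b (k • b1) h00 h01
    exact ⟨A, B, Or.inl h⟩
  · have hbb : wdg e b b1 = 0 := by
      obtain ⟨x, y, hxy⟩ := hP (e 0) (e 0 + e 1)
      rw [TensorProduct.tmul_add, map_add, h00, h01] at hxy
      exact (mul_eq_zero.1 (wdg_of_pure e hxy)).resolve_left hw
    have hbd : wdg e b d ≠ 0 := by
      intro h
      obtain ⟨k, rfl⟩ := smul_of_wdg e hb hbb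
      obtain ⟨l, rfl⟩ := smul_of_wdg e hb h
      refine hQ2 (k • a1 + l • c) b ?_
      rw [h01, h10, TensorProduct.add_tmul, TensorProduct.smul_tmul, TensorProduct.smul_tmul]
    have hac : wdg e a c = 0 := by
      obtain ⟨x, y, hxy⟩ := hP (e 0 + e 1) (e 0)
      rw [TensorProduct.add_tmul, map_add, h00, h10] at hxy
      exact (mul_eq_zero.1 (wdg_of_pure e hxy)).resolve_right hbd
    obtain ⟨k, rfl⟩ := smul_of_wdg e ha hac
    rw [TensorProduct.smul_tmul] at h10
    obtain ⟨A, B, h⟩ := main_case e ((TensorProduct.comm ℂ V V).trans g)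
      (fun v w => by simpa using hP w v) (by simpa using hQ1)
      (fun x y => by simpa [add_comm] using hQ2 x y) a b (k • d)
      (by simpa using h00) (by simpa using h10)
    refine ⟨A, B, Or.inr ?_⟩
    rw [← h]
    ext x y
    simp
end

section
/- Let 𝔤 be a finite-dimensional semisimple complex Lie algebra, let K be a field containing ℂ equipped with a derivation d : K → K vanishing on ℂ, and let N := K ⊗_ℂ 𝔤 with its K-Lie algebra structure. Let ∂₀ := d ⊗ id : N → N. Suppose ∂ : N → N is an additive map satisfying ∂(a·x) = d(a)·x + a·∂(x) for all a ∈ K, x ∈ N, and ∂[u,v] = [∂u,v] + [u,∂v] for all u, v ∈ N. Then there exists a unique S ∈ N such that ∂(x) = ∂₀(x) + [x,S] for all x ∈ N. -/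
open scoped TensorProduct

/-- The Killing property is preserved by extension of the base field. -/
theorem isKilling_baseChange_aux (g : Type) [LieRing g] [LieAlgebra ℂ g] [FiniteDimensional ℂ g]
    [LieAlgebra.IsKilling ℂ g] (K : Type) [Field K] [Algebra ℂ K] :
    LieAlgebra.IsKilling K (K ⊗[ℂ] g) := by
  classical
  let b := Module.finBasis ℂ g
  let bK := b.baseChange K
  have hnd : (killingForm ℂ g).Nondegenerate := LieAlgebra.IsKilling.killingForm_nondegenerate ℂ g
  have hdet : (LinearMap.BilinForm.toMatrix b (killingForm ℂ g)).det ≠ 0 :=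
    (LinearMap.BilinForm.nondegenerate_iff_det_ne_zero b).mp hnd
  have hM : LinearMap.BilinForm.toMatrix bK (killingForm K (K ⊗[ℂ] g)) =
      (LinearMap.BilinForm.toMatrix b (killingForm ℂ g)).map (algebraMap ℂ K) := by
    have key : killingForm K (K ⊗[ℂ] g) = (killingForm ℂ g).baseChange K :=
      LieModule.traceForm_baseChange ℂ g g K
    ext i j
    rw [key]
    simp [bK, LinearMap.BilinForm.toMatrix_apply, Algebra.algebraMap_eq_smul_one]
  have hdetK : (LinearMap.BilinForm.toMatrix bK (killingForm K (K ⊗[ℂ] g))).det ≠ 0 := by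
    rw [hM, ← RingHom.mapMatrix_apply, ← RingHom.map_det]
    simpa using hdet
  have hndK : (killingForm K (K ⊗[ℂ] g)).Nondegenerate :=
    (LinearMap.BilinForm.nondegenerate_iff_det_ne_zero bK).mpr hdetK
  constructor
  rw [← LieSubmodule.toSubmodule_eq_bot]
  exact (LieIdeal.coe_killingCompl_top K (K ⊗[ℂ] g)).trans
    (LinearMap.separatingLeft_iff_ker_eq_bot.mp hndK.1)

/-- Let `𝔤` be a finite-dimensional semisimple complex Lie algebra,
`K ⊇ ℂ` a field with a derivation `d` vanishing on `ℂ`, and `N = K ⊗_ℂ 𝔤` the base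
change, with `∂₀ = d ⊗ id`. Every additive map `∂ : N → N` which is a differential
structure over `(K, d)` and a derivation for the Lie bracket is of the form
`∂ = ∂₀ + [·, S]` for a unique `S ∈ N`. -/
theorem stmt17 (g : Type) [LieRing g] [LieAlgebra ℂ g] [FiniteDimensional ℂ g]
    [LieAlgebra.IsSemisimple ℂ g]
    (K : Type) [Field K] [Algebra ℂ K]
    (d : K → K)
    (hd_add : ∀ a b, d (a + b) = d a + d b)
    (hd_mul : ∀ a b, d (a * b) = d a * b + a * d b)
    (hd_const : ∀ c : ℂ, d (algebraMap ℂ K c) = 0)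
    (D : K ⊗[ℂ] g → K ⊗[ℂ] g)
    (hD_add : ∀ x y, D (x + y) = D x + D y)
    (hD_leibniz : ∀ (a : K) (x : K ⊗[ℂ] g), D (a • x) = d a • x + a • D x)
    (hD_bracket : ∀ u v : K ⊗[ℂ] g, D ⁅u, v⁆ = ⁅D u, v⁆ + ⁅u, D v⁆)
    -- `∂₀ = d ⊗ id`, characterized by its values on pure tensors
    (D₀ : K ⊗[ℂ] g → K ⊗[ℂ] g)
    (hD₀_add : ∀ x y, D₀ (x + y) = D₀ x + D₀ y)
    (hD₀_tmul : ∀ (a : K) (v : g), D₀ (a ⊗ₜ[ℂ] v) = d a ⊗ₜ[ℂ] v) :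
    ∃! S : K ⊗[ℂ] g, ∀ x, D x = D₀ x + ⁅x, S⁆ := by
  have hK : LieAlgebra.IsKilling K (K ⊗[ℂ] g) := isKilling_baseChange_aux g K
  -- `∂₀` is a differential structure
  have hD₀_zero : D₀ 0 = 0 := by simpa using hD₀_add 0 0
  have hD_zero : D 0 = 0 := by simpa using hD_add 0 0
  have hD₀_leibniz : ∀ (a : K) (x : K ⊗[ℂ] g), D₀ (a • x) = d a • x + a • D₀ x := by
    intro a x
    induction x with
    | zero => simp [hD₀_zero]
    | tmul b v =>
      rw [TensorProduct.smul_tmul', hD₀_tmul, hD₀_tmul, smul_eq_mul, hd_mul,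
        TensorProduct.add_tmul, TensorProduct.smul_tmul', TensorProduct.smul_tmul']
      rfl
    | add x y hx hy =>
      rw [smul_add, hD₀_add, hD₀_add, hx, hy, smul_add, smul_add]
      abel
  -- `∂₀` is a derivation of the Lie bracket
  have hD₀_bracket : ∀ u v : K ⊗[ℂ] g, D₀ ⁅u, v⁆ = ⁅D₀ u, v⁆ + ⁅u, D₀ v⁆ := by
    intro u v
    induction u with
    | zero => simp [hD₀_zero]
    | add x y hx hy =>
      rw [add_lie, hD₀_add, hD₀_add, hx, hy, add_lie, add_lie]
      abel
    | tmul a x =>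
      induction v with
      | zero => simp [hD₀_zero]
      | add v w hv hw =>
        rw [lie_add, hD₀_add, hD₀_add, hv, hw, lie_add, lie_add]
        abel
      | tmul b y =>
        simp only [LieAlgebra.ExtendScalars.bracket_tmul, hD₀_tmul, hd_mul,
          TensorProduct.add_tmul]
  let E : LieDerivation K (K ⊗[ℂ] g) (K ⊗[ℂ] g) :=
    { toFun := fun x => D x - D₀ x
      map_add' := by
        intro x y
        rw [hD_add, hD₀_add]
        abel
      map_smul' := by
        intro a x
        simp only [hD_leibniz, hD₀_leibniz, RingHom.id_apply, smul_sub]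
        abel
      leibniz' := by
        intro x y
        change D ⁅x, y⁆ - D₀ ⁅x, y⁆ = ⁅x, D y - D₀ y⁆ - ⁅y, D x - D₀ x⁆
        rw [hD_bracket, hD₀_bracket, ← lie_skew y (D x - D₀ x), lie_sub, sub_lie]
        abel }
  obtain ⟨T, hT⟩ := LieDerivation.IsKilling.exists_eq_ad E
  have hE : ∀ x, D x - D₀ x = ⁅T, x⁆ := by
    intro x
    have h := congrArg (fun F : LieDerivation K (K ⊗[ℂ] g) (K ⊗[ℂ] g) => F x) hT
    have h2 : ⁅T, x⁆ = E x := by simpa using h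
    exact h2.symm
  refine ⟨-T, ?_, ?_⟩
  · intro x
    change D x = D₀ x + ⁅x, -T⁆
    rw [lie_neg, lie_skew, ← hE x]
    abel
  · intro S hS
    have h0 : LieDerivation.ad K (K ⊗[ℂ] g) (S + T) = 0 := by
      ext x
      suffices h : ⁅S + T, x⁆ = 0 by simpa using h
      rw [add_lie, ← hE x, hS x, ← lie_skew S x]
      abel
    have h1 := (LieDerivation.IsKilling.ad_apply_eq_zero_iff K (K ⊗[ℂ] g) (S + T)).mp h0
    exact eq_neg_of_add_eq_zero_left h1
end
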